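/- arXiv:1202.3351 — 2 statements merged into one kernel-verified Lean document; each statement's English description precedes it below -/
import Mathlib

section
/- Let φ : (0,∞) → (0,∞) be continuous, let α : (0,∞) → (0,∞), fix r > 0, and define F(q) = ∫_r^q ds/φ(s) for q > 0. Let θ, δ > 0 and assume the dwell-time condition ∫_a^{α(a)} ds/φ(s) ≤ θ − δ for every a > 0. Let t_i < t_{i+1} with t_{i+1} − t_i ≥ θ, let y : [t_i, t_{i+1}) → (0,∞) be continuous, differentiable on (t_i, t_{i+1}), satisfy y′(τ) ≤ −φ(y(τ)) for all τ ∈ (t_i, t_{i+1}), and suppose the left limit y⁻ = lim_{τ→t_{i+1}⁻} y(τ) exists and is positive, and that the post-jump value y⁺ satisfies y⁺ ≤ α(y⁻). Then F(y⁺) ≤ F(y(t_i)) − δ; in particular y⁺ < y(t_i). -/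
open Filter Set

section PositiveHalfLine

variable {f : ℝ → ℝ} {r p q : ℝ}

theorem ContinuousOn.intervalIntegrable_of_Ioi_zero (hf : ContinuousOn f (Ioi 0))
    (hp : 0 < p) (hq : 0 < q) : IntervalIntegrable f MeasureTheory.volume p q :=
  (hf.mono fun _ hx => (lt_min hp hq).trans_le hx.1).intervalIntegrable

theorem ContinuousOn.hasDerivAt_integral_of_Ioi_zero (hf : ContinuousOn f (Ioi 0))
    (hr : 0 < r) (hq : 0 < q) : HasDerivAt (fun x => ∫ σ in r..x, f σ) (f q) q :=
  intervalIntegral.integral_hasDerivAt_right (hf.intervalIntegrable_of_Ioi_zero hr hq)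
    (hf.stronglyMeasurableAtFilter isOpen_Ioi q hq) (hf.continuousAt (Ioi_mem_nhds hq))

theorem strictMonoOn_integral_of_Ioi_zero (hf : ContinuousOn f (Ioi 0))
    (hpos : ∀ s > (0 : ℝ), 0 < f s) (hr : 0 < r) :
    StrictMonoOn (fun x => ∫ σ in r..x, f σ) (Ioi 0) := by
  refine strictMonoOn_of_deriv_pos (convex_Ioi 0)
    (fun x hx => (hf.hasDerivAt_integral_of_Ioi_zero hr hx).continuousAt.continuousWithinAt) ?_
  intro x hx
  rw [interior_Ioi] at hx
  rw [(hf.hasDerivAt_integral_of_Ioi_zero hr hx).deriv]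
  exact hpos x hx

end PositiveHalfLine

/-- Along a flow `y′ ≤ -φ(y)`, the primitive of `1 / φ` decreases at least at unit rate. -/
theorem antitoneOn_integral_comp_add_of_deriv_le {φ y : ℝ → ℝ} {r a b : ℝ}
    (hφc : ContinuousOn φ (Ioi 0)) (hφpos : ∀ s > (0 : ℝ), 0 < φ s) (hr : 0 < r)
    (hycont : ContinuousOn y (Ico a b)) (hypos : ∀ τ ∈ Ico a b, 0 < y τ)
    (hydiff : ∀ τ ∈ Ioo a b, DifferentiableAt ℝ y τ)
    (hyineq : ∀ τ ∈ Ioo a b, deriv y τ ≤ -φ (y τ)) :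
    AntitoneOn (fun τ => (∫ σ in r..y τ, 1 / φ σ) + τ) (Ico a b) := by
  have hf : ContinuousOn (fun σ => 1 / φ σ) (Ioi 0) :=
    continuousOn_const.div hφc fun s hs => (hφpos s hs).ne'
  have hderiv : ∀ τ ∈ Ioo a b, HasDerivAt (fun τ => (∫ σ in r..y τ, 1 / φ σ) + τ)
      (1 / φ (y τ) * deriv y τ + 1) τ := fun τ hτ =>
    ((hf.hasDerivAt_integral_of_Ioi_zero hr (hypos τ (Ioo_subset_Ico_self hτ))).comp τ
      (hydiff τ hτ).hasDerivAt).add (hasDerivAt_id τ)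
  refine antitoneOn_of_deriv_nonpos (convex_Ico a b) ?_ ?_ ?_
  · refine ContinuousOn.add (fun τ hτ => ?_) continuousOn_id
    exact (hf.hasDerivAt_integral_of_Ioi_zero hr (hypos τ hτ)).continuousAt.comp_continuousWithinAt
      (hycont τ hτ)
  · rw [interior_Ico]
    exact fun τ hτ => (hderiv τ hτ).differentiableAt.differentiableWithinAt
  · rw [interior_Ico]
    intro τ hτ
    have hpos := hφpos (y τ) (hypos τ (Ioo_subset_Ico_self hτ))
    rw [(hderiv τ hτ).deriv, one_div_mul_eq_div]
    have : deriv y τ / φ (y τ) ≤ -1 := by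
      rw [div_le_iff₀ hpos]
      linarith [hyineq τ hτ]
    linarith

/-- One-step estimate in the fixed dwell-time theorem: with `F(q) = ∫_r^q ds/φ(s)`, if the
dwell-time condition `∫_a^{α(a)} ds/φ(s) ≤ θ - δ` holds for all `a > 0`, `t_{i+1} - t_i ≥ θ`,
`y` flows with `y′ ≤ -φ(y)` on `(t_i, t_{i+1})`, has positive left limit `y⁻` at `t_{i+1}`,
and the post-jump value satisfies `y⁺ ≤ α(y⁻)`, then `F(y⁺) ≤ F(y(t_i)) - δ`;
in particular `y⁺ < y(t_i)`. -/
theorem one_step_dwell_time_estimate (φ : ℝ → ℝ)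
    (hφc : ContinuousOn φ (Set.Ioi 0)) (hφpos : ∀ s > (0 : ℝ), 0 < φ s)
    (α : ℝ → ℝ) (hα : ∀ s > (0 : ℝ), 0 < α s)
    (r : ℝ) (hr : 0 < r) (θ δ : ℝ) (hθ : 0 < θ) (hδ : 0 < δ)
    (hdwell : ∀ a > (0 : ℝ), (∫ σ in a..(α a), 1 / φ σ) ≤ θ - δ)
    (ti ti1 : ℝ) (hlt : ti < ti1) (hgap : θ ≤ ti1 - ti)
    (y : ℝ → ℝ) (hycont : ContinuousOn y (Set.Ico ti ti1))
    (hypos : ∀ τ ∈ Set.Ico ti ti1, 0 < y τ)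
    (hydiff : ∀ τ ∈ Set.Ioo ti ti1, DifferentiableAt ℝ y τ)
    (hyineq : ∀ τ ∈ Set.Ioo ti ti1, deriv y τ ≤ -φ (y τ))
    (yminus yplus : ℝ)
    (hyminus : Tendsto y (nhdsWithin ti1 (Set.Iio ti1)) (nhds yminus))
    (hyminus_pos : 0 < yminus) (hyplus_pos : 0 < yplus) (hyplus : yplus ≤ α yminus) :
    (∫ σ in r..yplus, 1 / φ σ) ≤ (∫ σ in r..(y ti), 1 / φ σ) - δ ∧ yplus < y ti := by
  have hf : ContinuousOn (fun σ => 1 / φ σ) (Ioi 0) :=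
    continuousOn_const.div hφc fun s hs => (hφpos s hs).ne'
  have hmono := strictMonoOn_integral_of_Ioi_zero hf
    (fun s hs => one_div_pos.2 (hφpos s hs)) hr
  have hti : ti ∈ Ico ti ti1 := left_mem_Ico.2 hlt
  have hflow : (∫ σ in r..yminus, 1 / φ σ) + ti1 ≤ (∫ σ in r..y ti, 1 / φ σ) + ti := by
    have hlim : Tendsto (fun τ => (∫ σ in r..y τ, 1 / φ σ) + τ) (nhdsWithin ti1 (Iio ti1))
        (nhds ((∫ σ in r..yminus, 1 / φ σ) + ti1)) :=
      ((hf.hasDerivAt_integral_of_Ioi_zero hr hyminus_pos).continuousAt.tendsto.comp hyminus).add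
        (tendsto_id.mono_left nhdsWithin_le_nhds)
    refine le_of_tendsto hlim ?_
    filter_upwards [Ioo_mem_nhdsLT hlt] with τ hτ
    exact antitoneOn_integral_comp_add_of_deriv_le hφc hφpos hr hycont hypos hydiff hyineq
      hti (Ioo_subset_Ico_self hτ) hτ.1.le
  have hjump : (∫ σ in r..yplus, 1 / φ σ) ≤ ∫ σ in r..α yminus, 1 / φ σ :=
    hmono.monotoneOn hyplus_pos (hα yminus hyminus_pos) hyplus
  have hadd := intervalIntegral.integral_add_adjacent_intervals
    (hf.intervalIntegrable_of_Ioi_zero hr hyminus_pos)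
    (hf.intervalIntegrable_of_Ioi_zero hyminus_pos (hα yminus hyminus_pos))
  have hmain : (∫ σ in r..yplus, 1 / φ σ) ≤ (∫ σ in r..(y ti), 1 / φ σ) - δ := by
    linarith [hdwell yminus hyminus_pos]
  exact ⟨hmain, (hmono.lt_iff_lt hyplus_pos (hypos ti hti)).1 (by linarith)⟩
end

section
/- Let θ, δ > 0 and let T = (t_k) be a strictly increasing sequence in (t*, ∞) with t_{k+1} − t_k ≥ θ and t_k → ∞. Let φ : (0,∞) → (0,∞) be continuous, let α : ℝ₊ → ℝ₊ be continuous, let r > 0, and set α̃ := max{ max_{0 ≤ s ≤ r} α(s), r }. Assume the dwell-time condition ∫_a^{α(a)} ds/φ(s) ≤ θ − δ for every a > 0. Let y : [t*, ∞) → ℝ₊ be right-continuous, possess left limits, be continuous and differentiable on each interval between consecutive elements of T and satisfy: (i) y′(τ) ≤ −φ(y(τ)) for every τ ∉ T at which y(τ) ≥ r; (ii) for every t_k ∈ T, if y⁻(t_k) ≥ r then y(t_k) ≤ α(y⁻(t_k)), and if y⁻(t_k) < r then y(t_k) ≤ α̃. If y(t*) ≤ r, then y(t) ≤ α̃ for all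 t ≥ t*. -/
open Filter Set

/-- A continuous function on `[s, t]` which is nonincreasing wherever it is at least `r` cannot
cross a level `M ≥ r` upwards. -/
theorem le_of_deriv_nonpos_above {y : ℝ → ℝ} {r s t M : ℝ} (hst : s ≤ t)
    (hc : ContinuousOn y (Icc s t)) (hd : ∀ u ∈ Ioo s t, r ≤ y u → deriv y u ≤ 0)
    (hdiff : ∀ u ∈ Ioo s t, DifferentiableAt ℝ y u) (hM : r ≤ M) (hs : y s ≤ M) : y t ≤ M := by
  have hcl : IsClosed (Icc s t ∩ y ⁻¹' Iic M) := hc.preimage_isClosed_of_isClosed isClosed_Icc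
    isClosed_Iic
  obtain ⟨τ, ⟨hτ, hyτ⟩, hmax⟩ := (isCompact_Icc.of_isClosed_subset hcl
    inter_subset_left).exists_isGreatest ⟨s, left_mem_Icc.2 hst, hs⟩
  have hanti : AntitoneOn y (Icc τ t) := by
    refine antitoneOn_of_deriv_nonpos (convex_Icc τ t) (hc.mono (Icc_subset_Icc_left hτ.1)) ?_ ?_
    · rw [interior_Icc]
      exact fun u hu ↦ (hdiff u ⟨hτ.1.trans_lt hu.1, hu.2⟩).differentiableWithinAt
    · rw [interior_Icc]
      intro u hu
      have hus : u ∈ Ioo s t := ⟨hτ.1.trans_lt hu.1, hu.2⟩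
      refine hd u hus (hM.trans ?_)
      by_contra! h
      exact hu.1.not_ge (hmax ⟨Ioo_subset_Icc_self hus, h.le⟩)
  exact (hanti (left_mem_Icc.2 hτ.2) (right_mem_Icc.2 hτ.2) hτ.2).trans hyτ

theorem intervalIntegrable_one_div {φ : ℝ → ℝ} (hφc : ContinuousOn φ (Ioi 0))
    (hφpos : ∀ s > (0 : ℝ), 0 < φ s) {a b : ℝ} (ha : 0 < a) (hb : 0 < b) :
    IntervalIntegrable (fun σ ↦ 1 / φ σ) MeasureTheory.volume a b := by
  have hsub : uIcc a b ⊆ Ioi 0 := fun x hx ↦ (lt_min ha hb).trans_le hx.1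
  exact (continuousOn_const.div (hφc.mono hsub)
    fun x hx ↦ (hφpos x (hsub hx)).ne').intervalIntegrable

theorem hasDerivAt_integral_one_div {φ : ℝ → ℝ} (hφc : ContinuousOn φ (Ioi 0))
    (hφpos : ∀ s > (0 : ℝ), 0 < φ s) {a x : ℝ} (ha : 0 < a) (hx : 0 < x) :
    HasDerivAt (fun x ↦ ∫ σ in a..x, 1 / φ σ) (1 / φ x) x := by
  have hc : ContinuousOn (fun σ ↦ 1 / φ σ) (Ioi 0) :=
    continuousOn_const.div hφc fun x hx ↦ (hφpos x hx).ne'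
  exact intervalIntegral.integral_hasDerivAt_right (intervalIntegrable_one_div hφc hφpos ha hx)
    (hc.stronglyMeasurableAtFilter isOpen_Ioi x hx) (hc.continuousAt (Ioi_mem_nhds hx))

/-- A positive function with `y' ≤ -φ(y)` on `(s, t)` needs at least the time `t - s` to be
accounted for by the integral of `1 / φ` between its end values. -/
theorem sub_le_integral_one_div {φ : ℝ → ℝ} (hφc : ContinuousOn φ (Ioi 0))
    (hφpos : ∀ s > (0 : ℝ), 0 < φ s) {y : ℝ → ℝ} {s t : ℝ} (hst : s ≤ t)
    (hc : ContinuousOn y (Icc s t)) (hdiff : ∀ u ∈ Ioo s t, DifferentiableAt ℝ y u)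
    (hpos : ∀ u ∈ Icc s t, 0 < y u) (hflow : ∀ u ∈ Ioo s t, deriv y u ≤ -φ (y u)) :
    t - s ≤ ∫ σ in (y t)..(y s), 1 / φ σ := by
  have ht := right_mem_Icc.2 hst
  have hs := left_mem_Icc.2 hst
  have hG : ∀ u ∈ Ioo s t, HasDerivAt (fun u ↦ (∫ σ in (y t)..(y u), 1 / φ σ) + u)
      (1 / φ (y u) * deriv y u + 1) u := fun u hu ↦
    ((hasDerivAt_integral_one_div hφc hφpos (hpos t ht)
      (hpos u (Ioo_subset_Icc_self hu))).comp u (hdiff u hu).hasDerivAt).add (hasDerivAt_id u)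
  have hanti : AntitoneOn (fun u ↦ (∫ σ in (y t)..(y u), 1 / φ σ) + u) (Icc s t) := by
    refine antitoneOn_of_deriv_nonpos (convex_Icc s t) ?_ ?_ ?_
    · refine ContinuousOn.add (fun u hu ↦ ?_) continuousOn_id
      exact (hasDerivAt_integral_one_div hφc hφpos (hpos t ht)
        (hpos u hu)).continuousAt.comp_continuousWithinAt (hc u hu)
    · rw [interior_Icc]
      exact fun u hu ↦ (hG u hu).differentiableAt.differentiableWithinAt
    · rw [interior_Icc]
      intro u hu
      have hp := hφpos _ (hpos u (Ioo_subset_Icc_self hu))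
      rw [(hG u hu).deriv, one_div, inv_mul_eq_div]
      have : deriv y u / φ (y u) ≤ -1 := by
        rw [div_le_iff₀ hp]
        linarith [hflow u hu]
      linarith
  have := hanti hs ht hst
  simp only [intervalIntegral.integral_same] at this
  linarith

/-- Behaviour of `y` on an interval `[s, e)` without jumps: an upper bound `M ≥ r` persists, and
if the left limit `a` at `e` exceeds `r`, the descent from `y s` to `a` takes time `e - s`. -/
theorem flow_segment {φ : ℝ → ℝ} (hφc : ContinuousOn φ (Ioi 0))
    (hφpos : ∀ s > (0 : ℝ), 0 < φ s) {y : ℝ → ℝ} {r s e : ℝ} (hr : 0 < r)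
    (hrc : ContinuousWithinAt y (Ici s) s) (hdiff : ∀ u ∈ Ioo s e, DifferentiableAt ℝ y u)
    (hflow : ∀ u ∈ Ioo s e, r ≤ y u → deriv y u ≤ -φ (y u)) :
    (∀ M, r ≤ M → y s ≤ M → ∀ t ∈ Ico s e, y t ≤ M) ∧
    (∀ a, s < e → Tendsto y (nhdsWithin e (Iio e)) (nhds a) → r < a →
      e - s ≤ ∫ σ in a..(y s), 1 / φ σ) := by
  have hc : ContinuousOn y (Ico s e) := by
    intro u hu
    rcases hu.1.eq_or_lt with rfl | h
    · exact hrc.mono Ico_subset_Ici_self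
    · exact (hdiff u ⟨h, hu.2⟩).continuousAt.continuousWithinAt
  have hbound : ∀ v ∈ Ico s e, ∀ M, r ≤ M → y v ≤ M → ∀ t ∈ Ico v e, y t ≤ M := by
    intro v hv M hM hvM t ht
    refine le_of_deriv_nonpos_above ht.1 (hc.mono fun u hu ↦ ⟨hv.1.trans hu.1, hu.2.trans_lt ht.2⟩)
      (fun u hu hru ↦ ?_) (fun u hu ↦ hdiff u ⟨hv.1.trans_lt hu.1, hu.2.trans ht.2⟩) hM hvM
    have := hflow u ⟨hv.1.trans_lt hu.1, hu.2.trans ht.2⟩ hru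
    linarith [hφpos _ (hr.trans_le hru)]
  refine ⟨fun M hM hsM t ht ↦ hbound s ⟨le_rfl, ht.1.trans_lt ht.2⟩ M hM hsM t ht, ?_⟩
  intro a hse hlim hra
  have habove : ∀ v ∈ Ico s e, r < y v := by
    intro v hv
    by_contra! h
    refine hra.not_ge (le_of_tendsto hlim ?_)
    filter_upwards [Ico_mem_nhdsLT hv.2] with t ht using hbound v hv r le_rfl h t ht
  have ha : 0 < a := hr.trans hra
  have hys : 0 < y s := hr.trans (habove s ⟨le_rfl, hse⟩)
  have hF := ((hasDerivAt_integral_one_div hφc hφpos hys ha).continuousAt.tendsto.comp hlim).neg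
  have hid : Tendsto (fun t : ℝ ↦ t - s) (nhdsWithin e (Iio e)) (nhds (e - s)) :=
    ((continuous_id.sub continuous_const).tendsto e).mono_left nhdsWithin_le_nhds
  rw [intervalIntegral.integral_symm]
  refine le_of_tendsto_of_tendsto hid hF ?_
  filter_upwards [Ico_mem_nhdsLT hse] with t ht
  have hsub : Ioo s t ⊆ Ioo s e := Ioo_subset_Ioo_right ht.2.le
  have hpos : ∀ u ∈ Icc s t, r < y u := fun u hu ↦ habove u ⟨hu.1, hu.2.trans_lt ht.2⟩
  have := sub_le_integral_one_div hφc hφpos ht.1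
    (hc.mono fun u hu ↦ ⟨hu.1, hu.2.trans_lt ht.2⟩) (fun u hu ↦ hdiff u (hsub hu))
    (fun u hu ↦ hr.trans (hpos u hu))
    (fun u hu ↦ hflow u (hsub hu) (hpos u (Ioo_subset_Icc_self hu)).le)
  rw [intervalIntegral.integral_symm] at this
  exact this

/-- Scalar invariance claim in the proof of the fixed dwell-time ISS theorem: with
impulse times separated by at least `θ`, the dwell-time condition
`∫_a^{α(a)} ds/φ(s) ≤ θ - δ` for all `a > 0`, and `α̃ = max{max_{0 ≤ s ≤ r} α(s), r}`,
once the scalar function `y` (flowing with `y′ ≤ -φ(y)` whenever `y ≥ r`, and jumping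
by at most `α` when the left limit is `≥ r`, resp. into `[0, α̃]` when the left limit is
`< r`) satisfies `y(t*) ≤ r`, it remains below `α̃` for all future times. -/
theorem invariance_after_threshold (θ δ tstar r : ℝ) (hθ : 0 < θ) (hδ : 0 < δ) (hr : 0 < r)
    (T : ℕ → ℝ) (hTmono : StrictMono T) (hTgt : ∀ k, tstar < T k)
    (hTgap : ∀ k, θ ≤ T (k + 1) - T k) (hTtop : Tendsto T atTop atTop)
    (φ : ℝ → ℝ) (hφc : ContinuousOn φ (Set.Ioi 0)) (hφpos : ∀ s > (0 : ℝ), 0 < φ s)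
    (α : ℝ → ℝ) (hαc : ContinuousOn α (Set.Ici 0)) (hαnn : ∀ s ≥ (0 : ℝ), 0 ≤ α s)
    (hdwell : ∀ a > (0 : ℝ), (∫ σ in a..(α a), 1 / φ σ) ≤ θ - δ)
    (y yminus : ℝ → ℝ)
    (hynn : ∀ t ≥ tstar, 0 ≤ y t)
    (hrc : ∀ t ≥ tstar, ContinuousWithinAt y (Set.Ici t) t)
    (hleft : ∀ t > tstar, Tendsto y (nhdsWithin t (Set.Iio t)) (nhds (yminus t)))
    (hnojump : ∀ t > tstar, t ∉ Set.range T → yminus t = y t)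
    (hdiff : ∀ t > tstar, t ∉ Set.range T → DifferentiableAt ℝ y t)
    (hflow : ∀ t > tstar, t ∉ Set.range T → r ≤ y t → deriv y t ≤ -φ (y t))
    (hjump_ge : ∀ k, r ≤ yminus (T k) → y (T k) ≤ α (yminus (T k)))
    (hjump_lt : ∀ k, yminus (T k) < r → y (T k) ≤ max (sSup (α '' Set.Icc 0 r)) r)
    (hinit : y tstar ≤ r) :
    ∀ t ≥ tstar, y t ≤ max (sSup (α '' Set.Icc 0 r)) r := by
  set A := max (sSup (α '' Icc 0 r)) r
  have hrA : r ≤ A := le_max_right _ _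
  have hαr : α r ≤ A := by
    refine (le_csSup ?_ (mem_image_of_mem α (right_mem_Icc.2 hr.le))).trans (le_max_left _ _)
    exact (isCompact_Icc.image_of_continuousOn (hαc.mono Icc_subset_Ici_self)).bddAbove
  have hnot0 : ∀ u ∈ Ioo tstar (T 0), u ∉ range T := by
    rintro _ hu ⟨j, rfl⟩
    exact absurd (hTmono.lt_iff_lt.1 hu.2) (Nat.not_lt_zero j)
  have hnot : ∀ k, ∀ u ∈ Ioo (T k) (T (k + 1)), u ∉ range T := by
    rintro k _ hu ⟨j, rfl⟩
    have h1 := hTmono.lt_iff_lt.1 hu.1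
    have h2 := hTmono.lt_iff_lt.1 hu.2
    omega
  have hseg0 := flow_segment hφc hφpos hr (hrc tstar le_rfl)
    (fun u hu ↦ hdiff u hu.1 (hnot0 u hu)) (fun u hu ↦ hflow u hu.1 (hnot0 u hu))
  have hseg := fun k ↦ flow_segment hφc hφpos hr (hrc (T k) (hTgt k).le)
    (fun u hu ↦ hdiff u ((hTgt k).trans hu.1) (hnot k u hu))
    (fun u hu ↦ hflow u ((hTgt k).trans hu.1) (hnot k u hu))
  have hjump_le : ∀ k, yminus (T k) ≤ r → y (T k) ≤ A := by
    intro k h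
    rcases h.eq_or_lt with h | h
    · have := hjump_ge k h.ge
      rw [h] at this
      exact this.trans hαr
    · exact hjump_lt k h
  have hT : ∀ k, y (T k) ≤ A := by
    intro k
    induction k with
    | zero =>
      refine hjump_le 0 (le_of_tendsto (hleft _ (hTgt 0)) ?_)
      filter_upwards [Ico_mem_nhdsLT (hTgt 0)] with t ht using hseg0.1 r le_rfl hinit t ht
    | succ k ih =>
      rcases le_or_gt (yminus (T (k + 1))) r with h | h
      · exact hjump_le _ h
      · have hdesc := (hseg k).2 _ (hTmono k.lt_succ_self) (hleft _ (hTgt (k + 1))) h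
        refine (hjump_ge (k + 1) h.le).trans ?_
        by_contra! hlt
        have hpos : 0 < yminus (T (k + 1)) := hr.trans h
        have hyα : y (T k) ≤ α (yminus (T (k + 1))) := ih.trans hlt.le
        have hApos : 0 < A := hr.trans_le hrA
        have hyk : 0 < y (T k) := by
          by_contra! h0
          have hneg := (hseg k).1 r le_rfl (h0.trans hr.le)
          refine h.not_ge (le_of_tendsto (hleft _ (hTgt (k + 1))) ?_)
          filter_upwards [Ico_mem_nhdsLT (hTmono k.lt_succ_self)] with t ht using hneg t ht
        have hadd := intervalIntegral.integral_add_adjacent_intervals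
          (intervalIntegrable_one_div hφc hφpos hpos hyk)
          (intervalIntegrable_one_div hφc hφpos hyk (hApos.trans hlt))
        have hnn : 0 ≤ ∫ σ in (y (T k))..(α (yminus (T (k + 1)))), 1 / φ σ :=
          intervalIntegral.integral_nonneg hyα
            fun u hu ↦ (one_div_pos.2 (hφpos u (hyk.trans_le hu.1))).le
        linarith [hdwell _ hpos, hTgap k]
  intro t ht
  have hex : ∃ k, t < T k := (hTtop.eventually_gt_atTop t).exists
  rcases lt_or_ge t (T 0) with h0 | h0
  · exact hseg0.1 A hrA (hinit.trans hrA) t ⟨ht, h0⟩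
  · classical
    obtain ⟨k, hk⟩ := Nat.exists_eq_succ_of_ne_zero
      (fun h ↦ (h ▸ Nat.find_spec hex : t < T 0).not_ge h0)
    have hlt := Nat.find_spec hex
    have hle := Nat.find_min hex (m := k) (by omega)
    rw [hk] at hlt
    exact (hseg k).1 A hrA (hT k) t ⟨not_lt.1 hle, hlt⟩
end
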